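/- The series B := y · S_y A has the form B = Σ_{n≥0} b_n u^{−2n} y^{3n} with b_0 = 1 and b_n = −((6n+1)/(6n−1)) a_n for every n ≥ 1. -/

import Mathlib

noncomputable section

/-- The base field `K = ℂ(u)`, rational functions in the variable `u`. -/
abbrev K : Type := RatFunc ℂ

/-- The variable `u ∈ K`. -/
def u : K := RatFunc.X

/-- The formal derivative `∂_y` of a formal Laurent series in `y` over `K`. -/
def derivLS (f : LaurentSeries K) : LaurentSeries K where
  coeff := fun n => ((n + 1 : ℤ) : K) * f.coeff (n + 1)
  isPWO_support' := by
    refine ((f.isPWO_support.add (Set.isPWO_singleton (-1 : ℤ))).mono ?_)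
    intro n hn
    simp only [Function.mem_support, ne_eq] at hn
    have hf : f.coeff (n + 1) ≠ 0 := fun h => hn (by simp [h])
    rw [Set.add_singleton]
    exact ⟨n + 1, by simpa [HahnSeries.mem_support] using hf, by ring⟩

/-- Multiplication of a formal Laurent series by `y^k`. -/
def ySh (k : ℤ) (f : LaurentSeries K) : LaurentSeries K :=
  (HahnSeries.single k (1 : K)) * f

/-- The operator `S_y f = u⁻² y³ ∂_y f + (1/2) u⁻² y² f + y⁻¹ f`. -/
def Sy (f : LaurentSeries K) : LaurentSeries K :=
  (u⁻¹ ^ 2) • ySh 3 (derivLS f) + ((1 / 2 : K) * u⁻¹ ^ 2) • ySh 2 f + ySh (-1) f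

/-- `a_n = (-1)^n (6n)! / (288^n (2n)! (3n)!)`. -/
def aQ (n : ℕ) : ℚ :=
  (-1) ^ n * ((6 * n).factorial : ℚ) /
    (288 ^ n * ((2 * n).factorial : ℚ) * ((3 * n).factorial : ℚ))

/-- The power-series-in-`y` `Σ_{n ≥ 0} c_n u^{-2n} y^{3n}` (viewed as a Laurent series)
attached to rational coefficients `c : ℕ → ℚ`. -/
def mkS (c : ℕ → ℚ) : LaurentSeries K :=
  HahnSeries.ofPowerSeries ℤ K
    (PowerSeries.mk fun m => if 3 ∣ m then ((c (m / 3) : ℚ) : K) * u⁻¹ ^ (2 * (m / 3)) else 0)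

/-- The series `A = Σ_{n ≥ 0} a_n u^{-2n} y^{3n}`. -/
def A : LaurentSeries K := mkS aQ

/-- The series `B := y · S_y A`. -/
def B : LaurentSeries K := ySh 1 (Sy A)

/-- `b_0 = 1` and `b_n = -((6n+1)/(6n-1)) a_n` for `n ≥ 1`. -/
def bQ (n : ℕ) : ℚ :=
  if n = 0 then 1 else -((6 * (n : ℚ) + 1) / (6 * (n : ℚ) - 1)) * aQ n

theorem coeff_ySh (k : ℤ) (f : LaurentSeries K) (m : ℤ) :
    (ySh k f).coeff m = f.coeff (m - k) := by
  rw [ySh, HahnSeries.coeff_single_mul, one_mul]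

theorem coeff_derivLS (f : LaurentSeries K) (m : ℤ) :
    (derivLS f).coeff m = ((m + 1 : ℤ) : K) * f.coeff (m + 1) := rfl

theorem coeff_mkS_of_neg (c : ℕ → ℚ) {m : ℤ} (hm : m < 0) : (mkS c).coeff m = 0 := by
  rw [mkS, PowerSeries.coeff_coe, if_pos hm]

theorem coeff_mkS_of_not_dvd (c : ℕ → ℚ) {m : ℤ} (hm : ¬ 3 ∣ m) : (mkS c).coeff m = 0 := by
  rw [mkS, PowerSeries.coeff_coe]
  split_ifs with h
  · rfl
  · rw [PowerSeries.coeff_mk, if_neg (by omega)]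

theorem coeff_mkS_three_mul (c : ℕ → ℚ) (n : ℕ) :
    (mkS c).coeff (3 * (n : ℤ)) = (c n : K) * u⁻¹ ^ (2 * n) := by
  have h : (3 * (n : ℤ)).natAbs = 3 * n := by omega
  rw [mkS, PowerSeries.coeff_coe, if_neg (by omega), PowerSeries.coeff_mk, h,
    if_pos (Dvd.intro n rfl), Nat.mul_div_cancel_left n (by norm_num)]

theorem coeff_B (m : ℤ) :
    B.coeff m = u⁻¹ ^ 2 * (((m - 3 : ℤ) : K) + 1 / 2) * A.coeff (m - 3) + A.coeff m := by
  rw [B, coeff_ySh, Sy, HahnSeries.coeff_add, HahnSeries.coeff_add, HahnSeries.coeff_smul,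
    HahnSeries.coeff_smul, coeff_ySh, coeff_ySh, coeff_ySh, coeff_derivLS, smul_eq_mul,
    smul_eq_mul, show m - 1 - 3 + 1 = m - 3 by ring, show m - 1 - 2 = m - 3 by ring,
    show m - 1 - -1 = m by ring]
  ring

theorem aQ_succ (n : ℕ) :
    aQ (n + 1) = -((6 * (n : ℚ) + 5) * (6 * n + 1) / (24 * (n + 1))) * aQ n := by
  have h6 : 6 * (n + 1) = 6 * n + 1 + 1 + 1 + 1 + 1 + 1 := by ring
  have h3 : 3 * (n + 1) = 3 * n + 1 + 1 + 1 := by ring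
  have h2 : 2 * (n + 1) = 2 * n + 1 + 1 := by ring
  have f2 : ((2 * n).factorial : ℚ) ≠ 0 := by positivity
  have f3 : ((3 * n).factorial : ℚ) ≠ 0 := by positivity
  unfold aQ
  rw [h6, h3, h2]
  simp only [Nat.factorial_succ]
  push_cast
  field_simp
  ring

theorem bQ_succ (n : ℕ) : bQ (n + 1) = (3 * (n : ℚ) + 1 / 2) * aQ n + aQ (n + 1) := by
  have h : 6 * ((n : ℚ) + 1) - 1 ≠ 0 := by
    have : (0 : ℚ) ≤ n := n.cast_nonneg
    linarith
  rw [bQ, if_neg n.succ_ne_zero, aQ_succ]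
  push_cast
  field_simp
  ring

/-- `B = Σ_{n≥0} b_n u^{-2n} y^{3n}` with `b_0 = 1` and `b_n = -((6n+1)/(6n-1)) a_n`
for `n ≥ 1`. -/
theorem stmt5 : B = mkS bQ := by
  ext m
  rw [coeff_B, A]
  by_cases hd : 3 ∣ m
  · rcases lt_or_ge m 0 with hm | hm
    · rw [coeff_mkS_of_neg _ hm, coeff_mkS_of_neg _ hm, coeff_mkS_of_neg _ (by omega)]
      ring
    · obtain ⟨k, rfl⟩ := hd
      lift k to ℕ using by omega
      rcases k with _ | n
      · rw [coeff_mkS_three_mul, coeff_mkS_three_mul, coeff_mkS_of_neg _ (by simp)]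
        simp [aQ, bQ]
      · rw [coeff_mkS_three_mul, coeff_mkS_three_mul, bQ_succ,
          show 3 * ((n + 1 : ℕ) : ℤ) - 3 = 3 * (n : ℤ) by push_cast; ring, coeff_mkS_three_mul]
        push_cast
        ring
  · rw [coeff_mkS_of_not_dvd _ hd, coeff_mkS_of_not_dvd _ hd,
      coeff_mkS_of_not_dvd _ (by omega)]
    ring

end
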